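/- With the notation of the stopping family: for S ∈ 𝒮 and an r-grandchild Ŝ of S (i.e. Ŝ ∈ ch_r(S)), the Haar projection 𝒫_Ŝ g := Σ_{Q ∈ 𝒮tp_r(S), Q ⊆ Ŝ} Δ_Q g satisfies ‖𝒫_Ŝ g‖_{L¹} ≲_{d,r,p,A} |Ŝ| ⟨|g|⟩_S; consequently Σ_{Ŝ ∈ ch_r(S)} ‖𝒫_Ŝ g‖_{L¹} ≲ ∫_S |g|. -/

import Mathlib

open MeasureTheory ENNReal Set

structure DyadicCube (d : ℕ) where
  j : ℤ
  m : Fin d → ℤ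

namespace DyadicCube

variable {d : ℕ}

/-- side length `2^{-j}` of the dyadic cube. -/
noncomputable def side (Q : DyadicCube d) : ℝ := 2 ^ (-Q.j)

/-- the dyadic cube `2^{-j}([0,1)^d + m)` as a subset of `ℝ^d`. -/
def toSet (Q : DyadicCube d) : Set (Fin d → ℝ) :=
  {x | ∀ i, (Q.m i : ℝ) * 2 ^ (-Q.j) ≤ x i ∧ x i < ((Q.m i : ℝ) + 1) * 2 ^ (-Q.j)}

/-- the concentric triple `3Q`. -/
def triple (Q : DyadicCube d) : Set (Fin d → ℝ) :=
  {x | ∀ i, ((Q.m i : ℝ) - 1) * 2 ^ (-Q.j) ≤ x i ∧ x i < ((Q.m i : ℝ) + 2) * 2 ^ (-Q.j)}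

/-- the centre of the cube. -/
noncomputable def center (Q : DyadicCube d) : Fin d → ℝ :=
  fun i => ((Q.m i : ℝ) + 1 / 2) * 2 ^ (-Q.j)

/-- the `k`-fold dyadic ancestor `Q^{(k)}`. -/
def ancestor (k : ℕ) (Q : DyadicCube d) : DyadicCube d :=
  ⟨Q.j - k, fun i => Int.fdiv (Q.m i) (2 ^ k)⟩

/-- the `k`-grandchildren `ch_k(Q)`. -/
def children (k : ℕ) (Q : DyadicCube d) : Set (DyadicCube d) :=
  {P | P.j = Q.j + k ∧ P.toSet ⊆ Q.toSet}

/-- distance between two sets in the `ℓ^∞` metric of `ℝ^d`. -/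
noncomputable def sdist (A B : Set (Fin d → ℝ)) : ℝ :=
  (⨅ a ∈ A, EMetric.infEdist a B).toReal

/-- average `⟨f⟩_A` of `f` over `A`. -/
noncomputable def avg (f : (Fin d → ℝ) → ℝ) (A : Set (Fin d → ℝ)) : ℝ :=
  (volume A).toReal⁻¹ * ∫ x in A, f x

/-- average `⟨|f|⟩_A`. -/
noncomputable def avgAbs (f : (Fin d → ℝ) → ℝ) (A : Set (Fin d → ℝ)) : ℝ :=
  avg (fun x => |f x|) A

/-- `Q` is `r`-good with parameter `γ`. -/
def IsGood (r : ℕ) (γ : ℝ) (Q : DyadicCube d) : Prop :=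
  ∀ P : DyadicCube d, 2 ^ r * Q.side ≤ P.side →
    Q.side ^ γ * P.side ^ (1 - γ) < sdist Q.toSet (frontier P.toSet)

/-- martingale (Haar) difference `Δ_Q f`. -/
noncomputable def mdiff (f : (Fin d → ℝ) → ℝ) (Q : DyadicCube d) (x : Fin d → ℝ) : ℝ :=
  ∑' J : {J : DyadicCube d // J ∈ children 1 Q},
    Set.indicator J.1.toSet (fun _ => avg f J.1.toSet - avg f Q.toSet) x

/-- `Σ_ε ⟨f, h_Q^ε⟩² = ‖Δ_Q f‖_{L²}²`, the total squared Haar coefficient on `Q`. -/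
noncomputable def haarSq (f : (Fin d → ℝ) → ℝ) (P : DyadicCube d) : ℝ :=
  ∫ x in P.toSet, (mdiff f P x) ^ 2

end DyadicCube

open DyadicCube

variable {d : ℕ}

/-- `Q ∈ 𝒮tp_r(S)`: `S` is the minimal cube of `𝒮` containing `Q^{(r)}`. -/
def inStpR (r : ℕ) (𝒮 : Set (DyadicCube d)) (S Q : DyadicCube d) : Prop :=
  (ancestor r Q).toSet ⊆ S.toSet ∧
    ∀ S' ∈ 𝒮, (ancestor r Q).toSet ⊆ S'.toSet → S.toSet ⊆ S'.toSet

/-- the Haar projection `𝒫_Ŝ g = Σ_{Q ∈ 𝒮tp_r(S), Q ⊆ Ŝ} Δ_Q g`. -/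
noncomputable def haarProj (r : ℕ) (𝒮 : Set (DyadicCube d)) (S Shat : DyadicCube d)
    (g : (Fin d → ℝ) → ℝ) (x : Fin d → ℝ) : ℝ :=
  ∑' Q : {Q : DyadicCube d // Q.toSet ⊆ Shat.toSet ∧ inStpR r 𝒮 S Q}, mdiff g Q.1 x

namespace DyadicCube

theorem toSet_eq_pi (Q : DyadicCube d) :
    Q.toSet = Set.pi univ fun i =>
      Ico ((Q.m i : ℝ) * 2 ^ (-Q.j)) (((Q.m i : ℝ) + 1) * 2 ^ (-Q.j)) := by
  ext x
  simp [toSet]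

theorem measurableSet_toSet (Q : DyadicCube d) : MeasurableSet Q.toSet := by
  rw [toSet_eq_pi]
  exact MeasurableSet.univ_pi fun _ => measurableSet_Ico

theorem volume_toSet (Q : DyadicCube d) :
    volume Q.toSet = ENNReal.ofReal ((2 ^ (-Q.j)) ^ d) := by
  rw [toSet_eq_pi, volume_pi_pi]
  have h : ∀ i, ((Q.m i : ℝ) + 1) * 2 ^ (-Q.j) - (Q.m i : ℝ) * 2 ^ (-Q.j) = 2 ^ (-Q.j) :=
    fun i => by ring
  simp only [Real.volume_Ico, h, Finset.prod_const, Finset.card_univ, Fintype.card_fin]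
  rw [ENNReal.ofReal_pow (by positivity)]

theorem toReal_volume_toSet (Q : DyadicCube d) :
    (volume Q.toSet).toReal = ((2 : ℝ) ^ (-Q.j)) ^ d := by
  rw [volume_toSet, ENNReal.toReal_ofReal (by positivity)]

theorem toReal_volume_toSet_pos (Q : DyadicCube d) : 0 < (volume Q.toSet).toReal := by
  rw [toReal_volume_toSet]
  positivity

theorem volume_toSet_ne_top (Q : DyadicCube d) : volume Q.toSet ≠ ∞ := by
  rw [volume_toSet]
  exact ENNReal.ofReal_ne_top

theorem toSet_nonempty (Q : DyadicCube d) : Q.toSet.Nonempty := by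
  refine ⟨fun i => (Q.m i : ℝ) * 2 ^ (-Q.j), fun i => ⟨le_rfl, ?_⟩⟩
  have : (0 : ℝ) < 2 ^ (-Q.j) := by positivity
  linarith

theorem eq_of_mem_of_mem {P Q : DyadicCube d} (hj : P.j = Q.j) {x : Fin d → ℝ}
    (hP : x ∈ P.toSet) (hQ : x ∈ Q.toSet) : P = Q := by
  obtain ⟨j, m⟩ := P
  obtain ⟨j', m'⟩ := Q
  obtain rfl : j = j' := hj
  congr 1
  funext i
  have hpos : (0 : ℝ) < 2 ^ (-j) := by positivity
  have h₁ : (m i : ℝ) < m' i + 1 :=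
    lt_of_mul_lt_mul_right ((hP i).1.trans_lt (hQ i).2) hpos.le
  have h₂ : (m' i : ℝ) < m i + 1 :=
    lt_of_mul_lt_mul_right ((hQ i).1.trans_lt (hP i).2) hpos.le
  norm_cast at h₁ h₂
  omega

theorem toSet_subset_ancestor (k : ℕ) (Q : DyadicCube d) :
    Q.toSet ⊆ (ancestor k Q).toSet := by
  intro x hx i
  have hs : (2 : ℝ) ^ (-(Q.j - k)) = 2 ^ k * 2 ^ (-Q.j) := by
    rw [neg_sub, sub_eq_add_neg, zpow_add₀ two_ne_zero, zpow_natCast]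
  have hpos : (0 : ℝ) < 2 ^ (-Q.j) := by positivity
  have hk : (0 : ℤ) < 2 ^ k := by positivity
  set q : ℤ := Int.fdiv (Q.m i) (2 ^ k) with hq
  rw [Int.fdiv_eq_ediv_of_nonneg _ hk.le] at hq
  have h₁ : q * 2 ^ k ≤ Q.m i := hq ▸ Int.ediv_mul_le _ hk.ne'
  have h₂ : Q.m i + 1 ≤ (q + 1) * 2 ^ k := hq ▸ Int.lt_ediv_add_one_mul_self _ hk
  have h₁' : (q : ℝ) * 2 ^ k ≤ Q.m i := by exact_mod_cast h₁
  have h₂' : (Q.m i : ℝ) + 1 ≤ (q + 1) * 2 ^ k := by exact_mod_cast h₂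
  change (q : ℝ) * 2 ^ (-(Q.j - k)) ≤ x i ∧ x i < ((q : ℝ) + 1) * 2 ^ (-(Q.j - k))
  rw [hs, ← mul_assoc, ← mul_assoc]
  exact ⟨(mul_le_mul_of_nonneg_right h₁' hpos.le).trans (hx i).1,
    (hx i).2.trans_le (mul_le_mul_of_nonneg_right h₂' hpos.le)⟩

/-- The dyadic cube of side length `2^{-k}` containing `x`. -/
noncomputable def cubeAt (k : ℤ) (x : Fin d → ℝ) : DyadicCube d :=
  ⟨k, fun i => ⌊x i * 2 ^ k⌋⟩

theorem mem_cubeAt (k : ℤ) (x : Fin d → ℝ) : x ∈ (cubeAt k x).toSet := by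
  intro i
  have hpos : (0 : ℝ) < 2 ^ k := by positivity
  change (⌊x i * 2 ^ k⌋ : ℝ) * 2 ^ (-k) ≤ x i ∧ x i < ((⌊x i * 2 ^ k⌋ : ℝ) + 1) * 2 ^ (-k)
  rw [zpow_neg, ← div_eq_mul_inv, ← div_eq_mul_inv, div_le_iff₀ hpos, lt_div_iff₀ hpos]
  exact ⟨Int.floor_le _, Int.lt_floor_add_one _⟩

theorem eq_cubeAt {Q : DyadicCube d} {x : Fin d → ℝ} (hx : x ∈ Q.toSet) :
    Q = cubeAt Q.j x :=
  eq_of_mem_of_mem rfl hx (mem_cubeAt _ _)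

theorem ancestor_cubeAt (n : ℕ) (k : ℤ) (x : Fin d → ℝ) :
    ancestor n (cubeAt k x) = cubeAt (k - n) x :=
  eq_cubeAt (toSet_subset_ancestor n _ (mem_cubeAt k x))

theorem cubeAt_subset {k l : ℤ} (h : k ≤ l) (x : Fin d → ℝ) :
    (cubeAt l x).toSet ⊆ (cubeAt k x).toSet := by
  obtain ⟨n, rfl⟩ := Int.le.dest h
  simpa [ancestor_cubeAt] using toSet_subset_ancestor n (cubeAt (k + n) x)

theorem le_of_toSet_subset (hd : d ≠ 0) {P Q : DyadicCube d} (h : P.toSet ⊆ Q.toSet) :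
    Q.j ≤ P.j := by
  have hv := ENNReal.toReal_mono Q.volume_toSet_ne_top (measure_mono (μ := volume) h)
  rw [toReal_volume_toSet, toReal_volume_toSet,
    pow_le_pow_iff_left₀ (by positivity) (by positivity) hd,
    zpow_le_zpow_iff_right₀ _root_.one_lt_two] at hv
  omega

theorem toSet_injective (hd : d ≠ 0) : Function.Injective (toSet (d := d)) := by
  intro P Q h
  obtain ⟨x, hx⟩ := P.toSet_nonempty
  exact eq_of_mem_of_mem
    (le_antisymm (le_of_toSet_subset hd h.ge) (le_of_toSet_subset hd h.le)) hx (h ▸ hx)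

instance : Countable (DyadicCube d) :=
  Function.Injective.countable (f := fun Q : DyadicCube d => (Q.j, Q.m)) fun P Q h => by
    cases P
    cases Q
    simpa using h

theorem avgAbs_nonneg (f : (Fin d → ℝ) → ℝ) (B : Set (Fin d → ℝ)) : 0 ≤ avgAbs f B :=
  mul_nonneg (by positivity) (integral_nonneg fun _ => abs_nonneg _)

theorem abs_avg_le_avgAbs (f : (Fin d → ℝ) → ℝ) (B : Set (Fin d → ℝ)) :
    |avg f B| ≤ avgAbs f B := by
  rw [avgAbs, avg, avg, abs_mul, abs_of_nonneg (by positivity : 0 ≤ (volume B).toReal⁻¹)]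
  exact mul_le_mul_of_nonneg_left abs_integral_le_integral_abs (by positivity)

theorem volume_mul_avgAbs (f : (Fin d → ℝ) → ℝ) (Q : DyadicCube d) :
    (volume Q.toSet).toReal * avgAbs f Q.toSet = ∫ x in Q.toSet, |f x| := by
  rw [avgAbs, avg, mul_inv_cancel_left₀ Q.toReal_volume_toSet_pos.ne']

theorem abs_avg_le_of_subset {f : (Fin d → ℝ) → ℝ} (hf : Integrable f) {P Q : DyadicCube d}
    {n : ℕ} (hj : P.j = Q.j + n) (h : P.toSet ⊆ Q.toSet) :
    |avg f P.toSet| ≤ (2 ^ n) ^ d * avgAbs f Q.toSet := by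
  refine (abs_avg_le_avgAbs f _).trans ?_
  have hv : (volume Q.toSet).toReal = (2 ^ n) ^ d * (volume P.toSet).toReal := by
    rw [toReal_volume_toSet, toReal_volume_toSet, ← mul_pow, hj,
      ← zpow_natCast (2 : ℝ) n, ← zpow_add₀ two_ne_zero]
    congr 2
    ring
  rw [← mul_le_mul_iff_right₀ P.toReal_volume_toSet_pos, volume_mul_avgAbs, ← mul_assoc,
    mul_comm (volume P.toSet).toReal, ← hv, volume_mul_avgAbs]
  exact setIntegral_mono_set hf.abs.integrableOn (ae_of_all _ fun _ => abs_nonneg _)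
    (ae_of_all _ h)

theorem mdiff_of_notMem (f : (Fin d → ℝ) → ℝ) {Q : DyadicCube d} {x : Fin d → ℝ}
    (hx : x ∉ Q.toSet) : mdiff f Q x = 0 := by
  rw [mdiff, tsum_congr (g := fun _ => (0 : ℝ)) fun J => ?_, tsum_zero]
  exact indicator_of_notMem (fun h => hx (J.2.2 h)) _

theorem mdiff_cubeAt (f : (Fin d → ℝ) → ℝ) (k : ℤ) (x : Fin d → ℝ) :
    mdiff f (cubeAt k x) x = avg f (cubeAt (k + 1) x).toSet - avg f (cubeAt k x).toSet := by
  have hmem : cubeAt (k + 1) x ∈ children 1 (cubeAt k x) :=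
    ⟨by simp [cubeAt], cubeAt_subset (by omega) x⟩
  rw [mdiff, tsum_eq_single ⟨_, hmem⟩, indicator_of_mem (mem_cubeAt _ _)]
  intro J hJ
  refine indicator_of_notMem (fun hx => hJ (Subtype.ext ?_)) _
  exact eq_of_mem_of_mem (J.2.1.trans hmem.1.symm) hx (mem_cubeAt _ _)

theorem mdiff_eq_zero_of_dim_eq_zero (hd : d = 0) (f : (Fin d → ℝ) → ℝ) (Q : DyadicCube d)
    (x : Fin d → ℝ) : mdiff f Q x = 0 := by
  subst hd
  have h : ∀ P : DyadicCube 0, P.toSet = univ := fun P => by ext; simp [toSet]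
  rw [eq_cubeAt (Q := Q) (x := x) (by simp [h]), mdiff_cubeAt]
  simp [h]

end DyadicCube

theorem exists_sum_range_ite_sub_eq {P : ℕ → Prop} [DecidablePred P]
    (hP : ∀ n, P (n + 1) → P n) (b : ℕ → ℝ) (k : ℕ) :
    ∃ m ≤ k, (∀ n < m, P n) ∧
      ∑ n ∈ Finset.range k, (if P n then b (n + 1) - b n else 0) = b m - b 0 := by
  have hanti : ∀ m n, m ≤ n → P n → P m := fun m n h =>
    Nat.le_induction id (fun n _ ih h => ih (hP n h)) n h
  suffices ∃ m ≤ k, (∀ n < m, P n) ∧ (m < k → ¬ P m) ∧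
      ∑ n ∈ Finset.range k, (if P n then b (n + 1) - b n else 0) = b m - b 0 by
    obtain ⟨m, h₁, h₂, -, h₃⟩ := this
    exact ⟨m, h₁, h₂, h₃⟩
  induction k with
  | zero => exact ⟨0, by simp⟩
  | succ k ih =>
    obtain ⟨m, hmk, hm, hmax, hsum⟩ := ih
    rw [Finset.sum_range_succ, hsum]
    by_cases hk : P k
    · obtain rfl : m = k := by
        by_contra hne
        exact hmax (by omega) (hanti m k hmk hk)
      refine ⟨m + 1, le_rfl, fun n hn => hanti n m (by omega) hk, by simp, ?_⟩
      simp [hk]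
    · refine ⟨m, by omega, hm, fun _ h => ?_, by simp [hk]⟩
      rcases hmk.lt_or_eq with hlt | rfl
      · exact hmax hlt h
      · exact hk h

theorem abs_tsum_le_of_abs_sum_range_le {a : ℕ → ℝ} {M : ℝ}
    (h : ∀ k, |∑ n ∈ Finset.range k, a n| ≤ M) : |∑' n, a n| ≤ M := by
  by_cases ha : Summable a
  · exact le_of_tendsto ha.hasSum.tendsto_sum_nat.abs (Filter.Eventually.of_forall h)
  · simpa [tsum_eq_zero_of_not_summable ha] using h 0

theorem haarProj_of_notMem (r : ℕ) (𝒮 : Set (DyadicCube d)) (S : DyadicCube d)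
    {Shat : DyadicCube d} (g : (Fin d → ℝ) → ℝ) {x : Fin d → ℝ} (hx : x ∉ Shat.toSet) :
    haarProj r 𝒮 S Shat g x = 0 := by
  rw [haarProj, tsum_congr (g := fun _ => (0 : ℝ)) fun Q => ?_, tsum_zero]
  exact mdiff_of_notMem g fun h => hx (Q.2.1 h)

theorem haarProj_eq_tsum_nat (hd : d ≠ 0) (r : ℕ) (𝒮 : Set (DyadicCube d))
    (S : DyadicCube d) {Shat : DyadicCube d} (g : (Fin d → ℝ) → ℝ) {x : Fin d → ℝ}
    (hx : x ∈ Shat.toSet) [DecidablePred fun n : ℕ => inStpR r 𝒮 S (cubeAt (Shat.j + n) x)] :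
    haarProj r 𝒮 S Shat g x =
      ∑' n : ℕ, if inStpR r 𝒮 S (cubeAt (Shat.j + n) x) then
        avg g (cubeAt (Shat.j + (n + 1 : ℕ)) x).toSet - avg g (cubeAt (Shat.j + n) x).toSet
      else 0 := by
  have hinj : Function.Injective fun n : ℕ => cubeAt (Shat.j + n) x := fun m n h => by
    have : Shat.j + m = Shat.j + n := congrArg DyadicCube.j h
    omega
  have hsupp : Function.support
      (indicator {Q | Q.toSet ⊆ Shat.toSet ∧ inStpR r 𝒮 S Q} fun Q => mdiff g Q x) ⊆
      range fun n : ℕ => cubeAt (Shat.j + n) x := by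
    intro Q hQ
    have hQT := mem_of_indicator_ne_zero hQ
    rw [Function.mem_support, indicator_of_mem hQT] at hQ
    have hxQ : x ∈ Q.toSet := by
      by_contra hxQ
      exact hQ (mdiff_of_notMem g hxQ)
    obtain ⟨n, hn⟩ := Int.le.dest (le_of_toSet_subset hd hQT.1)
    exact ⟨n, by simp only [hn]; exact (eq_cubeAt hxQ).symm⟩
  have hS : haarProj r 𝒮 S Shat g x = ∑' Q, indicator
      {Q | Q.toSet ⊆ Shat.toSet ∧ inStpR r 𝒮 S Q} (fun Q => mdiff g Q x) Q :=
    tsum_subtype {Q : DyadicCube d | Q.toSet ⊆ Shat.toSet ∧ inStpR r 𝒮 S Q}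
      fun Q => mdiff g Q x
  rw [hS, ← hinj.tsum_eq hsupp]
  refine tsum_congr fun n => ?_
  have hsub : (cubeAt (Shat.j + n) x).toSet ⊆ Shat.toSet := by
    conv_rhs => rw [eq_cubeAt hx]
    exact cubeAt_subset (by omega) x
  by_cases h : inStpR r 𝒮 S (cubeAt (Shat.j + n) x)
  · rw [indicator_of_mem (show _ ∈ {Q | Q.toSet ⊆ Shat.toSet ∧ inStpR r 𝒮 S Q} from ⟨hsub, h⟩),
      if_pos h, mdiff_cubeAt]
    push_cast
    rw [add_assoc]
  · rw [indicator_of_notMem fun h' => h h'.2, if_neg h]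

theorem abs_haarProj_le {r : ℕ} {A : ℝ} (hA : 1 ≤ A) {g : (Fin d → ℝ) → ℝ} (hg : Integrable g)
    {𝒮 : Set (DyadicCube d)} {S : DyadicCube d}
    (hS : ∀ Q : DyadicCube d, Q.toSet ⊆ S.toSet →
      (∀ S'' ∈ 𝒮, S''.toSet ⊆ S.toSet → S'' ≠ S → ¬Q.toSet ⊆ S''.toSet) →
      avgAbs g Q.toSet ≤ A * avgAbs g S.toSet)
    {Shat : DyadicCube d} (hShat : Shat ∈ children r S) (x : Fin d → ℝ) :
    |haarProj r 𝒮 S Shat g x| ≤ 2 * ((2 ^ (r + 1)) ^ d * A) * avgAbs g S.toSet := by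
  classical
  have hav := avgAbs_nonneg g S.toSet
  have hM : 0 ≤ 2 * ((2 ^ (r + 1)) ^ d * A) * avgAbs g S.toSet := by positivity
  rcases eq_or_ne d 0 with hd | hd
  · simpa [haarProj, mdiff_eq_zero_of_dim_eq_zero hd] using hM
  by_cases hx : x ∈ Shat.toSet
  swap
  · simpa [haarProj_of_notMem r 𝒮 S g hx] using hM
  rw [haarProj_eq_tsum_nat hd r 𝒮 S g hx]
  refine abs_tsum_le_of_abs_sum_range_le fun k => ?_
  obtain ⟨m, -, hm, hsum⟩ := exists_sum_range_ite_sub_eq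
    (P := fun n : ℕ => inStpR r 𝒮 S (cubeAt (Shat.j + n) x)) (fun n hn => by
      refine ⟨?_, fun S' hS' hsub => hn.2 S' hS' (Subset.trans ?_ hsub)⟩
      · conv_rhs => rw [eq_cubeAt (hShat.2 hx)]
        rw [ancestor_cubeAt, hShat.1]
        exact cubeAt_subset (by omega) x
      · rw [ancestor_cubeAt, ancestor_cubeAt]
        exact cubeAt_subset (by omega) x)
    (fun n : ℕ => avg g (cubeAt (Shat.j + n) x).toSet) k
  rw [hsum]
  have h0 : |avg g (cubeAt (Shat.j + (0 : ℕ)) x).toSet| ≤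
      (2 ^ (r + 1)) ^ d * A * avgAbs g S.toSet := by
    rw [Nat.cast_zero, add_zero, ← eq_cubeAt hx]
    refine (abs_avg_le_of_subset hg hShat.1 hShat.2).trans ?_
    gcongr
    calc ((2 : ℝ) ^ r) ^ d ≤ (2 ^ (r + 1)) ^ d := by gcongr <;> norm_num
      _ ≤ (2 ^ (r + 1)) ^ d * A := le_mul_of_one_le_right (by positivity) hA
  have hmain : |avg g (cubeAt (Shat.j + m) x).toSet| ≤
      (2 ^ (r + 1)) ^ d * A * avgAbs g S.toSet := by
    rcases m with _ | m
    · exact h0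
    obtain ⟨hsub, hmin⟩ := hm m (Nat.lt_succ_self m)
    have hmax := hS _ hsub fun S'' hS'' hle hne hQ =>
      hne (toSet_injective hd (hle.antisymm (hmin S'' hS'' hQ)))
    rw [ancestor_cubeAt] at hmax
    refine (abs_avg_le_of_subset hg (Q := cubeAt (Shat.j + m - r) x) (n := r + 1) ?_
      (cubeAt_subset (by push_cast; omega) x)).trans ?_
    · simp only [cubeAt]
      push_cast
      ring
    · rw [mul_assoc]
      gcongr
  calc _ ≤ _ := abs_sub _ _
    _ ≤ _ := add_le_add hmain h0
    _ = _ := by ring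

theorem tsum_volume_children_le (r : ℕ) (S : DyadicCube d) :
    ∑' Q : children r S, volume (Q : DyadicCube d).toSet ≤ volume S.toSet := by
  rw [← measure_iUnion (fun P Q hPQ => Set.disjoint_left.2 fun x hP hQ =>
    hPQ (Subtype.ext (eq_of_mem_of_mem (P.2.1.trans Q.2.1.symm) hP hQ)))
    fun Q => Q.1.measurableSet_toSet]
  exact measure_mono (iUnion_subset fun Q => Q.2.2)

/-- `L¹` bound for the Haar projection on a maximal cube: with `𝒮` a stopping family of `g` with
constant `A` (cubes in the stopping tree of any `S' ∈ 𝒮` have averages controlled by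
`A ⟨|g|⟩_{S'}`), for `S ∈ 𝒮` and `Ŝ ∈ ch_r(S)` one has `‖𝒫_Ŝ g‖_{L¹} ≤ C |Ŝ| ⟨|g|⟩_S`, and
consequently `Σ_{Ŝ ∈ ch_r(S)} ‖𝒫_Ŝ g‖_{L¹} ≤ C ∫_S |g|`, with `C = C(d,r,A)`. -/
theorem haar_projection_L1_bound (r : ℕ) {A : ℝ} (hA : 1 < A) :
    ∃ C > 0, ∀ (g : (Fin d → ℝ) → ℝ), Integrable g →
      ∀ 𝒮 : Set (DyadicCube d),
      (∀ S' ∈ 𝒮, ∀ Q : DyadicCube d, Q.toSet ⊆ S'.toSet →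
        (∀ S'' ∈ 𝒮, S''.toSet ⊆ S'.toSet → S'' ≠ S' → ¬Q.toSet ⊆ S''.toSet) →
        avgAbs g Q.toSet ≤ A * avgAbs g S'.toSet) →
      ∀ S ∈ 𝒮,
        (∀ Shat ∈ children r S,
          (∫ x, |haarProj r 𝒮 S Shat g x|) ≤
            C * (volume Shat.toSet).toReal * avgAbs g S.toSet) ∧
        (∑' Shat : children r S,
            ENNReal.ofReal (∫ x, |haarProj r 𝒮 S (Shat : DyadicCube d) g x|)) ≤
          ENNReal.ofReal (C * ∫ x in S.toSet, |g x|) := by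
  have hApos : 0 < A := one_pos.trans hA
  have hCpos : 0 < 2 * (((2 : ℝ) ^ (r + 1)) ^ d * A) := by positivity
  refine ⟨2 * ((2 ^ (r + 1)) ^ d * A), hCpos, fun g hg 𝒮 h𝒮 S hS => ?_⟩
  generalize hC : 2 * (((2 : ℝ) ^ (r + 1)) ^ d * A) = C at hCpos ⊢
  have hav := avgAbs_nonneg g S.toSet
  have hL1 : ∀ Shat ∈ children r S, (∫ x, |haarProj r 𝒮 S Shat g x|) ≤
      C * (volume Shat.toSet).toReal * avgAbs g S.toSet := by
    intro Shat hShat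
    calc ∫ x, |haarProj r 𝒮 S Shat g x|
        ≤ ∫ x, indicator Shat.toSet (fun _ => C * avgAbs g S.toSet) x := by
          refine integral_mono_of_nonneg (ae_of_all _ fun _ => abs_nonneg _)
            ((integrable_indicator_iff Shat.measurableSet_toSet).2
              (integrableOn_const Shat.volume_toSet_ne_top)) (ae_of_all _ fun x => ?_)
          by_cases hx : x ∈ Shat.toSet
          · simpa only [indicator_of_mem hx, hC] using
              abs_haarProj_le hA.le hg (h𝒮 S hS) hShat x
          · simp [haarProj_of_notMem r 𝒮 S g hx, hx]
      _ = C * (volume Shat.toSet).toReal * avgAbs g S.toSet := by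
          rw [integral_indicator Shat.measurableSet_toSet, setIntegral_const, smul_eq_mul,
            Measure.real]
          ring
  refine ⟨hL1, ?_⟩
  calc ∑' Shat : children r S,
        ENNReal.ofReal (∫ x, |haarProj r 𝒮 S (Shat : DyadicCube d) g x|)
      ≤ ∑' Shat : children r S,
        ENNReal.ofReal (C * avgAbs g S.toSet) * volume (Shat : DyadicCube d).toSet := by
        refine ENNReal.tsum_le_tsum fun Shat => ?_
        rw [← ENNReal.ofReal_toReal Shat.1.volume_toSet_ne_top,
          ← ENNReal.ofReal_mul (by positivity)]
        refine ENNReal.ofReal_le_ofReal ((hL1 Shat.1 Shat.2).trans_eq (by ring))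
    _ ≤ ENNReal.ofReal (C * avgAbs g S.toSet) * volume S.toSet := by
        rw [ENNReal.tsum_mul_left]
        gcongr
        exact tsum_volume_children_le r S
    _ = ENNReal.ofReal (C * ∫ x in S.toSet, |g x|) := by
        rw [← volume_mul_avgAbs, ← ENNReal.ofReal_toReal S.volume_toSet_ne_top,
          ← ENNReal.ofReal_mul (by positivity), ENNReal.toReal_ofReal (by positivity)]
        congr 1
        ring
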